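/- The global conductance Φ(K_σ) = inf{Φ(K_σ,A) : A measurable, 0 < π_σ(A) ≤ 1/2}, where Φ(K_σ,A) = (∫_A K_σ(x,A^c) f_σ(x) dx)/π_σ(A), satisfies lim_{σ→0} log(Φ(K_σ))/log(Φ_σ) = 1; that is, the half-line (−∞,0) asymptotically achieves the worst conductance on a logarithmic scale. -/

import Mathlib

open MeasureTheory Filter Set

/-- Gaussian density `φ_σ` with mean 0 and variance `σ²`. -/
noncomputable def gaussDensity (σ x : ℝ) : ℝ :=
  (Real.sqrt (2 * Real.pi * σ ^ 2))⁻¹ * Real.exp (-(x ^ 2) / (2 * σ ^ 2))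

/-- Density `f_σ` of the mixture `½ N(-1,σ²) + ½ N(1,σ²)`. -/
noncomputable def mixDensity (σ x : ℝ) : ℝ :=
  (1 / 2) * gaussDensity σ (x + 1) + (1 / 2) * gaussDensity σ (x - 1)

/-- The random-walk Metropolis transition probability `K_σ(x, A)` (real-valued form):
`K_σ(x,A) = ∫ 1_A(x+z) min(1, f_σ(x+z)/f_σ(x)) φ_σ(z) dz
            + 1_A(x) (1 − ∫ min(1, f_σ(x+z)/f_σ(x)) φ_σ(z) dz)`. -/
noncomputable def rwmProb (σ x : ℝ) (A : Set ℝ) : ℝ :=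
  (∫ z, A.indicator (fun _ => (1 : ℝ)) (x + z)
      * min 1 (mixDensity σ (x + z) / mixDensity σ x) * gaussDensity σ z)
  + A.indicator (fun _ => (1 : ℝ)) x
      * (1 - ∫ z, min 1 (mixDensity σ (x + z) / mixDensity σ x) * gaussDensity σ z)

/-- The conductance `Φ_σ` of the half line `(-∞,0)`:
`Φ_σ = 2 ∫_{(-∞,0)} K_σ(x,[0,∞)) f_σ(x) dx`. -/
noncomputable def PhiHalf (σ : ℝ) : ℝ :=
  2 * ∫ x in Set.Iio (0 : ℝ), rwmProb σ x (Set.Ici 0) * mixDensity σ x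

/-- The global conductance `Φ(K_σ) = inf {Φ(K_σ,A) : 0 < π_σ(A) ≤ 1/2}`. -/
noncomputable def PhiGlobal (σ : ℝ) : ℝ :=
  sInf { r : ℝ | ∃ A : Set ℝ, MeasurableSet A ∧ (0 < ∫ x in A, mixDensity σ x) ∧
    (∫ x in A, mixDensity σ x) ≤ 1 / 2 ∧
    r = (∫ x in A, rwmProb σ x Aᶜ * mixDensity σ x) / ∫ x in A, mixDensity σ x }

open scoped ENNReal

section StandardGaussian

/-- The unnormalised standard Gaussian density, with values in `ℝ≥0∞`. -/
noncomputable def stdDensity (x : ℝ) : ℝ≥0∞ := ENNReal.ofReal (Real.exp (-(x ^ 2) / 2))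

/-- The unnormalised flow density of random-walk Metropolis with unit steps and standard Gaussian
target. -/
noncomputable def stdFlow (x y : ℝ) : ℝ≥0∞ :=
  ENNReal.ofReal (min (Real.exp (-(x ^ 2) / 2)) (Real.exp (-(y ^ 2) / 2))
    * Real.exp (-((y - x) ^ 2) / 2))

/-- The `L¹` distance between `h x` and the values of `h` on `[-1, 1]`. -/
noncomputable def localOsc (h : ℝ → ℝ) (x : ℝ) : ℝ≥0∞ :=
  ∫⁻ u in Icc (-1 : ℝ) 1, edist (h x) (h u)

/-- The `L¹` Dirichlet form of `h` for the flow density `stdFlow`. -/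
noncomputable def stdDirichlet (h : ℝ → ℝ) : ℝ≥0∞ :=
  ∫⁻ x, ∫⁻ y, edist (h x) (h y) * stdFlow x y

@[fun_prop]
lemma measurable_stdDensity : Measurable stdDensity := by unfold stdDensity; fun_prop

@[fun_prop]
lemma measurable_stdFlow : Measurable fun p : ℝ × ℝ => stdFlow p.1 p.2 := by
  unfold stdFlow; fun_prop

lemma measurable_edist_comp {h : ℝ → ℝ} (hh : Measurable h) :
    Measurable fun p : ℝ × ℝ => edist (h p.1) (h p.2) :=
  (hh.comp measurable_fst).edist (hh.comp measurable_snd)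

lemma measurable_localOsc {h : ℝ → ℝ} (hh : Measurable h) : Measurable (localOsc h) :=
  (measurable_edist_comp hh).lintegral_prod_right'

lemma lintegral_stdDensity_ne_top : ∫⁻ x, stdDensity x ≠ ∞ := by
  have h := (integrable_exp_neg_mul_sq (b := 1 / 2) (by norm_num)).lintegral_lt_top
  refine ne_of_lt (lt_of_eq_of_lt (lintegral_congr fun x => ?_) h)
  unfold stdDensity; congr 2; ring

lemma stdDensity_le_one (x : ℝ) : stdDensity x ≤ 1 := by
  unfold stdDensity
  rw [← ENNReal.ofReal_one]
  apply ENNReal.ofReal_le_ofReal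
  rw [Real.exp_le_one_iff]
  nlinarith [sq_nonneg x]

lemma localOsc_le_localOsc_add {h : ℝ → ℝ} (x y : ℝ) :
    localOsc h x ≤ localOsc h y + 2 * edist (h x) (h y) := by
  unfold localOsc
  calc ∫⁻ u in Icc (-1 : ℝ) 1, edist (h x) (h u)
      ≤ ∫⁻ u in Icc (-1 : ℝ) 1, (edist (h y) (h u) + edist (h x) (h y)) :=
        lintegral_mono fun u => by rw [add_comm]; exact edist_triangle _ _ _
    _ = _ := by
        rw [lintegral_add_right _ measurable_const, lintegral_const, Measure.restrict_apply_univ,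
          Real.volume_Icc, mul_comm (edist (h x) (h y))]
        norm_num

lemma stdDensity_add_le {y t : ℝ} (hy : 1 ≤ y) (ht : 1 ≤ t) :
    stdDensity (y + t) ≤ 2⁻¹ * stdDensity y := by
  unfold stdDensity
  rw [show (2⁻¹ : ℝ≥0∞) = ENNReal.ofReal 2⁻¹ by
    rw [ENNReal.ofReal_inv_of_pos (by norm_num)]; norm_num,
    ← ENNReal.ofReal_mul (by norm_num)]
  apply ENNReal.ofReal_le_ofReal
  have h1 : Real.exp (-((y + t) ^ 2) / 2) ≤ Real.exp (-1) * Real.exp (-(y ^ 2) / 2) := by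
    rw [← Real.exp_add]; apply Real.exp_le_exp.2; nlinarith
  have h2 : Real.exp (-1) ≤ 2⁻¹ := by
    rw [Real.exp_neg]
    apply inv_anti₀ (by norm_num)
    linarith [Real.add_one_le_exp (1 : ℝ)]
  nlinarith [Real.exp_pos (-(y ^ 2) / 2)]

lemma one_le_mul_stdFlow {x y : ℝ} (hx : x ∈ Icc (-1 : ℝ) 1) (hy : y ∈ Icc (-1 : ℝ) 1) :
    1 ≤ ENNReal.ofReal (Real.exp 3) * stdFlow x y := by
  unfold stdFlow
  rw [← ENNReal.ofReal_mul (Real.exp_nonneg _), ← ENNReal.ofReal_one]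
  apply ENNReal.ofReal_le_ofReal
  obtain ⟨hx1, hx2⟩ := hx
  obtain ⟨hy1, hy2⟩ := hy
  have h1 : Real.exp (-1) ≤ min (Real.exp (-(x ^ 2) / 2)) (Real.exp (-(y ^ 2) / 2)) :=
    le_min (Real.exp_le_exp.2 (by nlinarith)) (Real.exp_le_exp.2 (by nlinarith))
  have h2 : Real.exp (-2) ≤ Real.exp (-((y - x) ^ 2) / 2) := Real.exp_le_exp.2 (by nlinarith)
  calc (1 : ℝ) = Real.exp 3 * (Real.exp (-1) * Real.exp (-2)) := by
        rw [← Real.exp_add, ← Real.exp_add]; norm_num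
    _ ≤ _ := by gcongr

lemma stdDensity_le_mul_stdFlow {x t : ℝ} (hx : 1 < x) (ht : t ∈ Icc (1 : ℝ) 2) :
    stdDensity x ≤ ENNReal.ofReal (Real.exp 3) * stdFlow x (x - t) := by
  unfold stdFlow stdDensity
  rw [← ENNReal.ofReal_mul (Real.exp_nonneg _)]
  apply ENNReal.ofReal_le_ofReal
  obtain ⟨ht1, ht2⟩ := ht
  rw [min_eq_left (Real.exp_le_exp.2 (by nlinarith)), ← Real.exp_add, ← Real.exp_add]
  exact Real.exp_le_exp.2 (by nlinarith)

lemma setLIntegral_localOsc_le {h : ℝ → ℝ} (hh : Measurable h) :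
    ∫⁻ x in Icc (-1 : ℝ) 1, localOsc h x ≤ ENNReal.ofReal (Real.exp 3) * stdDirichlet h := by
  unfold stdDirichlet
  have hm : Measurable fun p : ℝ × ℝ => edist (h p.1) (h p.2) * stdFlow p.1 p.2 :=
    (measurable_edist_comp hh).mul measurable_stdFlow
  rw [← lintegral_const_mul _ hm.lintegral_prod_right']
  refine (setLIntegral_mono' measurableSet_Icc fun x hx => ?_).trans (setLIntegral_le_lintegral _ _)
  rw [← lintegral_const_mul' _ _ ENNReal.ofReal_ne_top]
  refine (setLIntegral_mono' measurableSet_Icc fun y hy => ?_).trans (setLIntegral_le_lintegral _ _)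
  calc edist (h x) (h y) = edist (h x) (h y) * 1 := (mul_one _).symm
    _ ≤ edist (h x) (h y) * (ENNReal.ofReal (Real.exp 3) * stdFlow x y) := by
        gcongr; exact one_le_mul_stdFlow hx hy
    _ = _ := by ring

lemma setLIntegral_edist_sub_le {h : ℝ → ℝ} (hh : Measurable h) :
    ∫⁻ x in Ioi (1 : ℝ), ∫⁻ t in Icc (1 : ℝ) 2, stdDensity x * edist (h x) (h (x - t))
      ≤ ENNReal.ofReal (Real.exp 3) * stdDirichlet h := by
  unfold stdDirichlet
  have hm : Measurable fun p : ℝ × ℝ => edist (h p.1) (h p.2) * stdFlow p.1 p.2 :=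
    (measurable_edist_comp hh).mul measurable_stdFlow
  rw [← lintegral_const_mul _ hm.lintegral_prod_right']
  refine (setLIntegral_mono' measurableSet_Ioi fun x hx => ?_).trans (setLIntegral_le_lintegral _ _)
  rw [← lintegral_const_mul' _ _ ENNReal.ofReal_ne_top,
    ← lintegral_sub_left_eq_self (μ := volume)
      (fun y => ENNReal.ofReal (Real.exp 3) * (edist (h x) (h y) * stdFlow x y)) x]
  refine (setLIntegral_mono' measurableSet_Icc fun t ht => ?_).trans (setLIntegral_le_lintegral _ _)
  calc stdDensity x * edist (h x) (h (x - t))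
      ≤ (ENNReal.ofReal (Real.exp 3) * stdFlow x (x - t)) * edist (h x) (h (x - t)) := by
        gcongr; exact stdDensity_le_mul_stdFlow hx ht
    _ = _ := by ring

lemma setLIntegral_shift_le {h : ℝ → ℝ} (hh : Measurable h) {t : ℝ} (ht : t ∈ Icc (1 : ℝ) 2) :
    ∫⁻ x in Ioi (1 : ℝ), stdDensity x * localOsc h (x - t)
      ≤ 2⁻¹ * (∫⁻ x in Ioi (1 : ℝ), stdDensity x * localOsc h x)
        + ∫⁻ x in Icc (-1 : ℝ) 1, localOsc h x := by
  rw [← lintegral_indicator measurableSet_Ioi, ← lintegral_add_right_eq_self _ t,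
    ← lintegral_const_mul' _ _ (by simp), ← lintegral_indicator measurableSet_Ioi,
    ← lintegral_indicator measurableSet_Icc,
    ← lintegral_add_right _ ((measurable_localOsc hh).indicator measurableSet_Icc)]
  refine lintegral_mono fun y => ?_
  obtain ⟨ht1, ht2⟩ := ht
  by_cases h1 : y + t ∈ Ioi (1 : ℝ)
  · rw [indicator_of_mem h1, add_sub_cancel_right]
    by_cases h2 : y ∈ Ioi (1 : ℝ)
    · rw [indicator_of_mem h2]
      refine le_trans ?_ le_self_add
      rw [← mul_assoc]
      gcongr
      exact stdDensity_add_le (le_of_lt h2) ht1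
    · rw [indicator_of_notMem h2, indicator_of_mem, zero_add]
      · exact mul_le_of_le_one_left' (stdDensity_le_one _)
      · simp only [mem_Ioi, not_lt, mem_Icc] at *
        constructor <;> linarith
  · rw [indicator_of_notMem h1]; exact zero_le

lemma setLIntegral_stdDensity_mul_localOsc_le {h : ℝ → ℝ} (hh : Measurable h)
    (hb : ∀ x y, edist (h x) (h y) ≤ 1) :
    ∫⁻ x in Ioi (1 : ℝ), stdDensity x * localOsc h x
      ≤ 6 * (ENNReal.ofReal (Real.exp 3) * stdDirichlet h) := by
  set J := ∫⁻ x in Ioi (1 : ℝ), stdDensity x * localOsc h x with hJ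
  set S := ENNReal.ofReal (Real.exp 3) * stdDirichlet h with hS
  have hloc : ∀ x, localOsc h x ≤ 2 := fun x => by
    refine (lintegral_mono fun u => hb x u).trans ?_
    rw [lintegral_const, Measure.restrict_apply_univ, Real.volume_Icc]
    norm_num
  have hJtop : J ≠ ∞ := by
    refine ne_top_of_le_ne_top (ENNReal.mul_ne_top lintegral_stdDensity_ne_top
      (ENNReal.ofNat_ne_top (n := 2))) ?_
    rw [← lintegral_mul_const _ measurable_stdDensity]
    refine (setLIntegral_le_lintegral _ _).trans (lintegral_mono fun x => ?_)
    gcongr; exact hloc x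
  have hvol : volume.restrict (Icc (1 : ℝ) 2) univ = 1 := by
    rw [Measure.restrict_apply_univ, Real.volume_Icc]; norm_num
  have hm1 : Measurable fun p : ℝ × ℝ => stdDensity p.1 * localOsc h (p.1 - p.2) :=
    (measurable_stdDensity.comp measurable_fst).mul
      ((measurable_localOsc hh).comp (measurable_fst.sub measurable_snd))
  have hm2 : Measurable fun p : ℝ × ℝ => stdDensity p.1 * edist (h p.1) (h (p.1 - p.2)) :=
    (measurable_stdDensity.comp measurable_fst).mul
      ((hh.comp measurable_fst).edist (hh.comp (measurable_fst.sub measurable_snd)))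
  have hstep : ∀ x, stdDensity x * localOsc h x
      ≤ (∫⁻ t in Icc (1 : ℝ) 2, stdDensity x * localOsc h (x - t))
        + 2 * ∫⁻ t in Icc (1 : ℝ) 2, stdDensity x * edist (h x) (h (x - t)) := fun x => by
    have hmx : Measurable fun t => stdDensity x * localOsc h (x - t) :=
      ((measurable_localOsc hh).comp (measurable_const.sub measurable_id)).const_mul _
    rw [← lintegral_const_mul' _ _ (by simp),
      ← lintegral_add_left hmx]
    calc stdDensity x * localOsc h x
        = ∫⁻ _ in Icc (1 : ℝ) 2, stdDensity x * localOsc h x := by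
          rw [lintegral_const, hvol, mul_one]
      _ ≤ _ := lintegral_mono fun t => by
          calc _ ≤ stdDensity x * (localOsc h (x - t) + 2 * edist (h x) (h (x - t))) := by
                gcongr; exact localOsc_le_localOsc_add x (x - t)
            _ = _ := by ring
  have hmain : J ≤ 2⁻¹ * J + 3 * S := by
    calc J ≤ ∫⁻ x in Ioi (1 : ℝ), ((∫⁻ t in Icc (1 : ℝ) 2, stdDensity x * localOsc h (x - t))
            + 2 * ∫⁻ t in Icc (1 : ℝ) 2, stdDensity x * edist (h x) (h (x - t))) :=
          lintegral_mono fun x => hstep x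
      _ = (∫⁻ t in Icc (1 : ℝ) 2, ∫⁻ x in Ioi (1 : ℝ), stdDensity x * localOsc h (x - t))
            + 2 * ∫⁻ x in Ioi (1 : ℝ), ∫⁻ t in Icc (1 : ℝ) 2,
              stdDensity x * edist (h x) (h (x - t)) := by
          rw [lintegral_add_left hm1.lintegral_prod_right',
            lintegral_const_mul _ hm2.lintegral_prod_right',
            lintegral_lintegral_swap hm1.aemeasurable]
      _ ≤ (∫⁻ _ in Icc (1 : ℝ) 2, (2⁻¹ * J + S)) + 2 * S := by
          refine add_le_add ?_ (mul_le_mul_right ?_ _)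
          · refine setLIntegral_mono' measurableSet_Icc fun t ht => ?_
            refine (setLIntegral_shift_le hh ht).trans ?_
            gcongr
            exact setLIntegral_localOsc_le hh
          · exact setLIntegral_edist_sub_le hh
      _ = _ := by rw [lintegral_const, hvol]; ring
  have hhalf : 2⁻¹ * J + 2⁻¹ * J = J := by
    rw [← add_mul, ENNReal.inv_two_add_inv_two, one_mul]
  have h3 : 2⁻¹ * J ≤ 3 * S := by
    rw [← ENNReal.add_le_add_iff_left (a := 2⁻¹ * J) (ENNReal.mul_ne_top (by simp) hJtop), hhalf]
    exact hmain
  calc J = 2⁻¹ * J + 2⁻¹ * J := hhalf.symm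
    _ ≤ 3 * S + 3 * S := by gcongr
    _ = 6 * S := by ring

lemma stdDirichlet_comp_neg (h : ℝ → ℝ) : stdDirichlet (fun x => h (-x)) = stdDirichlet h := by
  unfold stdDirichlet
  rw [← lintegral_neg_eq_self]
  refine lintegral_congr fun x => ?_
  rw [← lintegral_neg_eq_self]
  refine lintegral_congr fun y => ?_
  unfold stdFlow
  simp only [neg_neg]
  rw [neg_sq, neg_sq, show -y - -x = -(y - x) by ring, neg_sq]

lemma localOsc_comp_neg (h : ℝ → ℝ) (x : ℝ) :
    localOsc (fun x => h (-x)) (-x) = localOsc h x := by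
  unfold localOsc
  rw [← lintegral_indicator measurableSet_Icc, ← lintegral_indicator measurableSet_Icc,
    ← lintegral_neg_eq_self]
  refine lintegral_congr fun y => ?_
  have : -y ∈ Icc (-1 : ℝ) 1 ↔ y ∈ Icc (-1 : ℝ) 1 := by
    simp only [mem_Icc]; constructor <;> rintro ⟨_, _⟩ <;> constructor <;> linarith
  by_cases hy : y ∈ Icc (-1 : ℝ) 1
  · rw [indicator_of_mem hy, indicator_of_mem (this.2 hy)]; simp only [neg_neg]
  · rw [indicator_of_notMem hy, indicator_of_notMem (mt this.1 hy)]

lemma lintegral_stdDensity_mul_localOsc_le {h : ℝ → ℝ} (hh : Measurable h)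
    (hb : ∀ x y, edist (h x) (h y) ≤ 1) :
    ∫⁻ x, stdDensity x * localOsc h x ≤ 13 * (ENNReal.ofReal (Real.exp 3) * stdDirichlet h) := by
  set S := ENNReal.ofReal (Real.exp 3) * stdDirichlet h with hS
  have h1 := setLIntegral_stdDensity_mul_localOsc_le hh hb
  have h2 : ∫⁻ x in Iio (-1 : ℝ), stdDensity x * localOsc h x ≤ 6 * S := by
    have := setLIntegral_stdDensity_mul_localOsc_le (h := fun x => h (-x)) (hh.comp measurable_neg)
      (fun x y => hb _ _)
    rw [stdDirichlet_comp_neg] at this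
    refine le_trans (le_of_eq ?_) this
    rw [← lintegral_indicator measurableSet_Iio, ← lintegral_indicator measurableSet_Ioi,
      ← lintegral_neg_eq_self]
    refine lintegral_congr fun y => ?_
    have hiff : -y ∈ Iio (-1 : ℝ) ↔ y ∈ Ioi (1 : ℝ) := by simp
    by_cases hy : y ∈ Ioi (1 : ℝ)
    · rw [indicator_of_mem hy, indicator_of_mem (hiff.2 hy)]
      have := localOsc_comp_neg h (-y)
      rw [neg_neg] at this
      rw [← this]
      unfold stdDensity; rw [neg_sq]
    · rw [indicator_of_notMem hy, indicator_of_notMem (mt hiff.1 hy)]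
  have h3 : ∫⁻ x in Icc (-1 : ℝ) 1, stdDensity x * localOsc h x ≤ S :=
    (lintegral_mono fun x => mul_le_of_le_one_left' (stdDensity_le_one x)).trans
      (setLIntegral_localOsc_le hh)
  calc ∫⁻ x, stdDensity x * localOsc h x
      = ∫⁻ x in (Iio (-1) ∪ Icc (-1) 1) ∪ Ioi (1 : ℝ), stdDensity x * localOsc h x := by
        rw [Iio_union_Icc_eq_Iic (by norm_num), Iic_union_Ioi, setLIntegral_univ]
    _ ≤ 6 * S + S + 6 * S :=
        (lintegral_union_le _ _ _).trans
          (add_le_add ((lintegral_union_le _ _ _).trans (add_le_add h2 h3)) h1)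
    _ = 13 * S := by ring

end StandardGaussian

section Indicator

lemma edist_indicator_one_of_mem_of_notMem {A : Set ℝ} {x y : ℝ} (hx : x ∈ A) (hy : y ∉ A) :
    edist (A.indicator (1 : ℝ → ℝ) x) (A.indicator (1 : ℝ → ℝ) y) = 1 := by
  rw [indicator_of_mem hx, indicator_of_notMem hy, edist_dist, Pi.one_apply]
  simp

lemma edist_indicator_one_of_iff {A : Set ℝ} {x y : ℝ} (h : x ∈ A ↔ y ∈ A) :
    edist (A.indicator (1 : ℝ → ℝ) x) (A.indicator (1 : ℝ → ℝ) y) = 0 := by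
  by_cases hx : x ∈ A
  · rw [indicator_of_mem hx, indicator_of_mem (h.1 hx)]; simp
  · rw [indicator_of_notMem hx, indicator_of_notMem (mt h.2 hx)]; simp

lemma edist_indicator_one_le_one (A : Set ℝ) (x y : ℝ) :
    edist (A.indicator (1 : ℝ → ℝ) x) (A.indicator (1 : ℝ → ℝ) y) ≤ 1 := by
  by_cases h : x ∈ A ↔ y ∈ A
  · rw [edist_indicator_one_of_iff h]; exact zero_le
  · by_cases hx : x ∈ A
    · have hy : y ∉ A := fun hy => h ⟨fun _ => hy, fun _ => hx⟩
      rw [edist_indicator_one_of_mem_of_notMem hx hy]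
    · have hy : y ∈ A := by tauto
      rw [edist_comm, edist_indicator_one_of_mem_of_notMem hy hx]

lemma lintegral_edist_indicator_of_mem {A : Set ℝ} (hA : MeasurableSet A) (μ : Measure ℝ)
    (k : ℝ → ℝ≥0∞) {x : ℝ} (hx : x ∈ A) :
    ∫⁻ y, edist (A.indicator (1 : ℝ → ℝ) x) (A.indicator (1 : ℝ → ℝ) y) * k y ∂μ
      = ∫⁻ y in Aᶜ, k y ∂μ := by
  rw [← lintegral_indicator hA.compl]
  refine lintegral_congr fun y => ?_
  by_cases hy : y ∈ A
  · rw [edist_indicator_one_of_iff (by tauto), indicator_of_notMem (by simpa using hy), zero_mul]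
  · rw [edist_indicator_one_of_mem_of_notMem hx hy, indicator_of_mem hy, one_mul]

lemma lintegral_edist_indicator_of_notMem {A : Set ℝ} (hA : MeasurableSet A) (μ : Measure ℝ)
    (k : ℝ → ℝ≥0∞) {x : ℝ} (hx : x ∉ A) :
    ∫⁻ y, edist (A.indicator (1 : ℝ → ℝ) x) (A.indicator (1 : ℝ → ℝ) y) * k y ∂μ
      = ∫⁻ y in A, k y ∂μ := by
  rw [← lintegral_indicator hA]
  refine lintegral_congr fun y => ?_
  by_cases hy : y ∈ A
  · rw [edist_comm, edist_indicator_one_of_mem_of_notMem hy hx, indicator_of_mem hy, one_mul]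
  · rw [edist_indicator_one_of_iff (by tauto), indicator_of_notMem hy, zero_mul]

lemma stdFlow_comm (x y : ℝ) : stdFlow x y = stdFlow y x := by
  unfold stdFlow
  rw [min_comm, show (y - x) ^ 2 = (x - y) ^ 2 by ring]

lemma stdDirichlet_indicator {A : Set ℝ} (hA : MeasurableSet A) :
    stdDirichlet (A.indicator 1) = 2 * ∫⁻ x in A, ∫⁻ y in Aᶜ, stdFlow x y := by
  unfold stdDirichlet
  rw [← lintegral_add_compl _ hA, two_mul]
  congr 1
  · exact setLIntegral_congr_fun hA fun x hx => lintegral_edist_indicator_of_mem hA _ _ hx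
  · rw [lintegral_lintegral_swap (f := stdFlow) measurable_stdFlow.aemeasurable]
    refine setLIntegral_congr_fun hA.compl fun x hx => ?_
    refine (lintegral_edist_indicator_of_notMem hA _ _ hx).trans ?_
    exact lintegral_congr fun y => stdFlow_comm _ _

/-- Random-walk Metropolis with unit steps has positive conductance for a standard Gaussian
target. -/
lemma min_setLIntegral_stdDensity_le {A : Set ℝ} (hA : MeasurableSet A) :
    min (∫⁻ x in A, stdDensity x) (∫⁻ x in Aᶜ, stdDensity x)
      ≤ ENNReal.ofReal (13 * Real.exp 3) * ∫⁻ x in A, ∫⁻ y in Aᶜ, stdFlow x y := by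
  have hm : Measurable (A.indicator (1 : ℝ → ℝ)) := measurable_one.indicator hA
  have key := lintegral_stdDensity_mul_localOsc_le hm (edist_indicator_one_le_one A)
  rw [stdDirichlet_indicator hA, ← lintegral_add_compl _ hA] at key
  set Q := ∫⁻ x in A, ∫⁻ y in Aᶜ, stdFlow x y
  set M := min (∫⁻ x in A, stdDensity x) (∫⁻ x in Aᶜ, stdDensity x) with hM
  set q := volume.restrict (Icc (-1 : ℝ) 1) Aᶜ with hq
  set p := volume.restrict (Icc (-1 : ℝ) 1) A with hp
  have hpq : p + q = 2 := by
    rw [hp, hq, measure_add_measure_compl hA, Measure.restrict_apply_univ, Real.volume_Icc]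
    norm_num
  have h1 : ∀ x ∈ A, localOsc (A.indicator 1) x = q := fun x hx => by
    have := lintegral_edist_indicator_of_mem hA (volume.restrict (Icc (-1 : ℝ) 1)) 1 hx
    simpa [localOsc, hp, hq, Measure.restrict_apply, hA, hA.compl] using this
  have h2 : ∀ x ∈ Aᶜ, localOsc (A.indicator 1) x = p := fun x hx => by
    have := lintegral_edist_indicator_of_notMem hA (volume.restrict (Icc (-1 : ℝ) 1)) 1 hx
    simpa [localOsc, hp, hq, Measure.restrict_apply, hA, hA.compl] using this
  rw [setLIntegral_congr_fun hA (g := fun x => stdDensity x * q) fun x hx => by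
      simp only [h1 x hx],
    setLIntegral_congr_fun hA.compl (g := fun x => stdDensity x * p) fun x hx => by
      simp only [h2 x hx],
    lintegral_mul_const _ measurable_stdDensity, lintegral_mul_const _ measurable_stdDensity] at key
  have h3 : 2 * M ≤ 2 * (ENNReal.ofReal (13 * Real.exp 3) * Q) := by
    calc 2 * M = M * q + M * p := by rw [← hpq]; ring
      _ ≤ _ := add_le_add (mul_le_mul_left (min_le_left _ _) _)
          (mul_le_mul_left (min_le_right _ _) _)
      _ ≤ _ := key
      _ = _ := by
        rw [ENNReal.ofReal_mul (by norm_num), ENNReal.ofReal_ofNat]; ring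
  exact (ENNReal.mul_le_mul_iff_right (by simp) (by simp)).1 h3

end Indicator

section Scaling

lemma setLIntegral_eq_comp_affine {σ : ℝ} (hσ : 0 < σ) (m : ℝ) {A : Set ℝ}
    (hA : MeasurableSet A) (F : ℝ → ℝ≥0∞) :
    ∫⁻ x in A, F x
      = ENNReal.ofReal σ * ∫⁻ r in (fun r => m + σ * r) ⁻¹' A, F (m + σ * r) := by
  have hpre : MeasurableSet ((fun r => m + σ * r) ⁻¹' A) :=
    (by fun_prop : Measurable fun r => m + σ * r) hA
  rw [← lintegral_indicator hA, ← lintegral_indicator hpre,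
    ← lintegral_add_left_eq_self (A.indicator F) m]
  conv_lhs => rw [← Real.smul_map_volume_mul_left hσ.ne']
  rw [lintegral_smul_measure, (measurableEmbedding_mulLeft₀ hσ.ne').lintegral_map, abs_of_pos hσ]
  rfl

lemma gaussDensity_eq {σ : ℝ} (hσ : 0 < σ) (x : ℝ) :
    gaussDensity σ x = σ⁻¹ * (√(2 * Real.pi))⁻¹ * Real.exp (-(x ^ 2) / (2 * σ ^ 2)) := by
  unfold gaussDensity
  rw [Real.sqrt_mul (by positivity), Real.sqrt_sq hσ.le, mul_inv, mul_comm σ⁻¹]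

lemma gaussDensity_mul {σ : ℝ} (hσ : 0 < σ) (r : ℝ) :
    gaussDensity σ (σ * r) = σ⁻¹ * (√(2 * Real.pi))⁻¹ * Real.exp (-(r ^ 2) / 2) := by
  rw [gaussDensity_eq hσ]
  congr 2
  field_simp

lemma gaussDensity_pos {σ : ℝ} (hσ : 0 < σ) (x : ℝ) : 0 < gaussDensity σ x := by
  rw [gaussDensity_eq hσ]; positivity

@[fun_prop]
lemma continuous_gaussDensity (σ : ℝ) : Continuous (gaussDensity σ) := by
  unfold gaussDensity; fun_prop

/-- Random-walk Metropolis with step `σ` has conductance bounded below uniformly in `σ` and `m`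
for the target `N(m, σ²)`. -/
lemma min_setLIntegral_gaussDensity_le {σ : ℝ} (hσ : 0 < σ) (m : ℝ) {A : Set ℝ}
    (hA : MeasurableSet A) :
    min (∫⁻ x in A, ENNReal.ofReal (gaussDensity σ (x - m)))
        (∫⁻ x in Aᶜ, ENNReal.ofReal (gaussDensity σ (x - m)))
      ≤ ENNReal.ofReal (13 * Real.exp 3 * √(2 * Real.pi)) * ∫⁻ x in A, ∫⁻ y in Aᶜ,
        ENNReal.ofReal (min (gaussDensity σ (x - m)) (gaussDensity σ (y - m))
          * gaussDensity σ (y - x)) := by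
  set a : ℝ := (√(2 * Real.pi))⁻¹ with ha
  have ha0 : 0 < a := by positivity
  set B := (fun r => m + σ * r) ⁻¹' A with hB
  have hBm : MeasurableSet B := (by fun_prop : Measurable fun r => m + σ * r) hA
  have hdens : ∀ r, ENNReal.ofReal (gaussDensity σ (m + σ * r - m))
      = ENNReal.ofReal (σ⁻¹ * a) * stdDensity r := fun r => by
    rw [add_sub_cancel_left, gaussDensity_mul hσ, stdDensity,
      ENNReal.ofReal_mul (by positivity)]
  have hmass : ∀ {A' : Set ℝ}, MeasurableSet A' →
      ∫⁻ x in A', ENNReal.ofReal (gaussDensity σ (x - m))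
        = ENNReal.ofReal a * ∫⁻ r in (fun r => m + σ * r) ⁻¹' A', stdDensity r := fun hA' => by
    rw [setLIntegral_eq_comp_affine hσ m hA']
    simp only [hdens]
    rw [lintegral_const_mul _ measurable_stdDensity, ← mul_assoc, ← ENNReal.ofReal_mul hσ.le,
      mul_inv_cancel_left₀ hσ.ne']
  have hker : ∀ r s, ENNReal.ofReal (min (gaussDensity σ (m + σ * r - m))
      (gaussDensity σ (m + σ * s - m)) * gaussDensity σ (m + σ * s - (m + σ * r)))
        = ENNReal.ofReal (σ⁻¹ * a * (σ⁻¹ * a)) * stdFlow r s := fun r s => by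
    rw [add_sub_cancel_left, add_sub_cancel_left,
      show m + σ * s - (m + σ * r) = σ * (s - r) by ring, gaussDensity_mul hσ, gaussDensity_mul hσ,
      gaussDensity_mul hσ, ← mul_min_of_nonneg _ _ (by positivity), stdFlow,
      ← ENNReal.ofReal_mul (by positivity)]
    congr 1; ring
  have hflow : ∫⁻ x in A, ∫⁻ y in Aᶜ,
        ENNReal.ofReal (min (gaussDensity σ (x - m)) (gaussDensity σ (y - m))
          * gaussDensity σ (y - x))
      = ENNReal.ofReal (a * a) * ∫⁻ r in B, ∫⁻ s in Bᶜ, stdFlow r s := by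
    simp only [setLIntegral_eq_comp_affine hσ m hA.compl]
    rw [setLIntegral_eq_comp_affine hσ m hA]
    simp only [hker]
    rw [lintegral_const_mul' _ _ ENNReal.ofReal_ne_top]
    have : ∀ r, ∫⁻ s in (fun r => m + σ * r) ⁻¹' Aᶜ,
        ENNReal.ofReal (σ⁻¹ * a * (σ⁻¹ * a)) * stdFlow r s
          = ENNReal.ofReal (σ⁻¹ * a * (σ⁻¹ * a)) * ∫⁻ s in Bᶜ, stdFlow r s := fun r =>
      lintegral_const_mul' _ _ ENNReal.ofReal_ne_top
    simp only [this]
    rw [lintegral_const_mul' _ _ ENNReal.ofReal_ne_top, ← mul_assoc, ← mul_assoc,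
      ← ENNReal.ofReal_mul (by positivity), ← ENNReal.ofReal_mul (by positivity)]
    congr 2
    field_simp
  rw [hflow, hmass hA, hmass hA.compl, ← mul_assoc, ← ENNReal.ofReal_mul (by positivity)]
  have h := min_setLIntegral_stdDensity_le hBm
  rw [show 13 * Real.exp 3 * √(2 * Real.pi) * (a * a) = a * (13 * Real.exp 3) by
    rw [ha]; field_simp, ENNReal.ofReal_mul ha0.le, mul_assoc]
  refine le_trans ?_ (mul_le_mul_right h _)
  rw [preimage_compl]
  rcases le_total (∫⁻ x in B, stdDensity x) (∫⁻ x in Bᶜ, stdDensity x) with h' | h'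
  · rw [min_eq_left h']; exact min_le_left _ _
  · rw [min_eq_right h']; exact min_le_right _ _

end Scaling

section Flow

variable {σ : ℝ}

lemma gaussDensity_sub_eq_gaussianPDFReal (σ m x : ℝ) :
    gaussDensity σ (x - m) = ProbabilityTheory.gaussianPDFReal m ⟨σ ^ 2, sq_nonneg σ⟩ x := by
  rfl

lemma lintegral_gaussDensity_sub (hσ : 0 < σ) (m : ℝ) :
    ∫⁻ x, ENNReal.ofReal (gaussDensity σ (x - m)) = 1 := by
  simp only [gaussDensity_sub_eq_gaussianPDFReal]
  refine ProbabilityTheory.lintegral_gaussianPDFReal_eq_one m fun h => ?_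
  exact (pow_pos hσ 2).ne' (congrArg NNReal.toReal h)

lemma integrable_gaussDensity_sub (σ m : ℝ) : Integrable fun x => gaussDensity σ (x - m) := by
  simp only [gaussDensity_sub_eq_gaussianPDFReal]
  exact ProbabilityTheory.integrable_gaussianPDFReal m _

@[fun_prop]
lemma continuous_mixDensity (σ : ℝ) : Continuous (mixDensity σ) := by
  unfold mixDensity; fun_prop

lemma mixDensity_eq (σ x : ℝ) :
    mixDensity σ x = 1 / 2 * gaussDensity σ (x - 1) + 1 / 2 * gaussDensity σ (x - -1) := by
  rw [mixDensity, sub_neg_eq_add, add_comm]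

lemma mixDensity_pos (hσ : 0 < σ) (x : ℝ) : 0 < mixDensity σ x := by
  have h1 := gaussDensity_pos hσ (x + 1)
  have h2 := gaussDensity_pos hσ (x - 1)
  unfold mixDensity; positivity

lemma integrable_mixDensity (σ : ℝ) : Integrable (mixDensity σ) := by
  rw [funext (mixDensity_eq σ)]
  exact ((integrable_gaussDensity_sub σ 1).const_mul _).add
    ((integrable_gaussDensity_sub σ (-1)).const_mul _)

lemma half_gaussDensity_le_mixDensity (hσ : 0 < σ) {m : ℝ} (hm : m = 1 ∨ m = -1) (x : ℝ) :
    1 / 2 * gaussDensity σ (x - m) ≤ mixDensity σ x := by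
  have h1 := gaussDensity_pos hσ (x - 1)
  have h2 := gaussDensity_pos hσ (x - -1)
  rw [mixDensity_eq]
  rcases hm with rfl | rfl <;> linarith

/-- The mass of `A` under `N(m, σ²)`. -/
noncomputable def gaussMass (σ m : ℝ) (A : Set ℝ) : ℝ≥0∞ :=
  ∫⁻ x in A, ENNReal.ofReal (gaussDensity σ (x - m))

/-- The mass of `A` under the mixture. -/
noncomputable def mixMass (σ : ℝ) (A : Set ℝ) : ℝ≥0∞ :=
  ∫⁻ x in A, ENNReal.ofReal (mixDensity σ x)

/-- The flow density of the Metropolis chain targeting the mixture. -/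
noncomputable def mixFlow (σ x y : ℝ) : ℝ :=
  min (mixDensity σ x) (mixDensity σ y) * gaussDensity σ (y - x)

/-- The stationary flow of the Metropolis chain from `A` to its complement. -/
noncomputable def setFlow (σ : ℝ) (A : Set ℝ) : ℝ≥0∞ :=
  ∫⁻ x in A, ∫⁻ y in Aᶜ, ENNReal.ofReal (mixFlow σ x y)

lemma gaussMass_add_compl (hσ : 0 < σ) (m : ℝ) {A : Set ℝ} (hA : MeasurableSet A) :
    gaussMass σ m A + gaussMass σ m Aᶜ = 1 := by
  rw [gaussMass, gaussMass, lintegral_add_compl _ hA, lintegral_gaussDensity_sub hσ]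

lemma two_mul_mixMass (hσ : 0 < σ) (A : Set ℝ) :
    2 * mixMass σ A = gaussMass σ 1 A + gaussMass σ (-1) A := by
  unfold mixMass gaussMass
  rw [← lintegral_add_left (by fun_prop), ← lintegral_const_mul _ (by fun_prop)]
  refine lintegral_congr fun x => ?_
  have h1 := gaussDensity_pos hσ (x - 1)
  have h2 := gaussDensity_pos hσ (x - -1)
  rw [mixDensity_eq, ← ENNReal.ofReal_add h1.le h2.le, ← ENNReal.ofReal_ofNat,
    ← ENNReal.ofReal_mul (by norm_num)]
  congr 1; ring

lemma setIntegral_mixDensity (hσ : 0 < σ) (A : Set ℝ) :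
    ∫ x in A, mixDensity σ x = (mixMass σ A).toReal :=
  integral_eq_lintegral_of_nonneg_ae (ae_of_all _ fun x => (mixDensity_pos hσ x).le)
    (continuous_mixDensity σ).aestronglyMeasurable

lemma mixMass_ne_top (σ : ℝ) (A : Set ℝ) : mixMass σ A ≠ ∞ :=
  (integrable_mixDensity σ).restrict.lintegral_lt_top.ne

lemma continuous_mixFlow (σ : ℝ) : Continuous fun p : ℝ × ℝ => mixFlow σ p.1 p.2 := by
  unfold mixFlow; fun_prop

lemma mixFlow_pos (hσ : 0 < σ) (x y : ℝ) : 0 < mixFlow σ x y :=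
  mul_pos (lt_min (mixDensity_pos hσ x) (mixDensity_pos hσ y)) (gaussDensity_pos hσ _)

lemma mixFlow_le (hσ : 0 < σ) (x y : ℝ) :
    mixFlow σ x y ≤ mixDensity σ x * gaussDensity σ (y - x) :=
  mul_le_mul_of_nonneg_right (min_le_left _ _) (gaussDensity_pos hσ _).le

lemma integrable_mixFlow (hσ : 0 < σ) (x : ℝ) : Integrable (mixFlow σ x) := by
  refine ((integrable_gaussDensity_sub σ x).const_mul (mixDensity σ x)).mono'
    ((continuous_mixFlow σ).comp (Continuous.prodMk_right x)).aestronglyMeasurable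
    (ae_of_all _ fun y => ?_)
  rw [Real.norm_of_nonneg (mixFlow_pos hσ x y).le]
  exact mixFlow_le hσ x y

lemma setFlow_ne_top (hσ : 0 < σ) (A : Set ℝ) : setFlow σ A ≠ ∞ := by
  refine ne_top_of_le_ne_top (mixMass_ne_top σ A) (lintegral_mono fun x => ?_)
  calc ∫⁻ y in Aᶜ, ENNReal.ofReal (mixFlow σ x y)
      ≤ ∫⁻ y, ENNReal.ofReal (mixDensity σ x) * ENNReal.ofReal (gaussDensity σ (y - x)) := by
        refine (setLIntegral_le_lintegral _ _).trans (lintegral_mono fun y => ?_)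
        rw [← ENNReal.ofReal_mul (mixDensity_pos hσ x).le]
        exact ENNReal.ofReal_le_ofReal (mixFlow_le hσ x y)
    _ = _ := by
        rw [lintegral_const_mul' _ _ ENNReal.ofReal_ne_top, lintegral_gaussDensity_sub hσ, mul_one]

lemma rwmProb_mul_mixDensity (hσ : 0 < σ) {A : Set ℝ} (hA : MeasurableSet A) {x : ℝ}
    (hx : x ∈ A) :
    rwmProb σ x Aᶜ * mixDensity σ x = ∫ y in Aᶜ, mixFlow σ x y := by
  have hf := mixDensity_pos hσ x
  rw [rwmProb, indicator_of_notMem (s := Aᶜ) (a := x) (by simpa using hx), zero_mul, add_zero,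
    ← integral_mul_const, ← integral_indicator hA.compl,
    ← integral_add_left_eq_self (Aᶜ.indicator (mixFlow σ x)) x]
  refine integral_congr_ae (ae_of_all _ fun z => ?_)
  by_cases hz : x + z ∈ Aᶜ
  · simp only [indicator_of_mem hz, mixFlow, add_sub_cancel_left]
    rw [one_mul, mul_right_comm, min_mul_of_nonneg _ _ hf.le, one_mul, div_mul_cancel₀ _ hf.ne']
  · simp only [indicator_of_notMem hz, zero_mul]

lemma setIntegral_rwmProb_compl (hσ : 0 < σ) {A : Set ℝ} (hA : MeasurableSet A) :
    ∫ x in A, rwmProb σ x Aᶜ * mixDensity σ x = (setFlow σ A).toReal := by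
  rw [setIntegral_congr_fun hA fun x hx => rwmProb_mul_mixDensity hσ hA hx,
    integral_eq_lintegral_of_nonneg_ae
      (ae_of_all _ fun x => integral_nonneg fun y => (mixFlow_pos hσ x y).le)
      ((continuous_mixFlow σ).stronglyMeasurable.integral_prod_right'
        (ν := volume.restrict Aᶜ)).aestronglyMeasurable]
  unfold setFlow
  congr 1
  refine lintegral_congr fun x => ?_
  exact ofReal_integral_eq_lintegral_ofReal (integrable_mixFlow hσ x).restrict
    (ae_of_all _ fun y => (mixFlow_pos hσ x y).le)

end Flow

section LowerBound

variable {σ : ℝ}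

/-- The constant in the conductance bound for a single mode. -/
noncomputable def modeConst : ℝ := 26 * Real.exp 3 * √(2 * Real.pi)

/-- The exponential rate of the lower bound for the flow between the two modes. -/
noncomputable def rateFactor (σ : ℝ) : ℝ :=
  (Real.exp (-(5 / 8)) / (16 * Real.pi)) * Real.exp (-(2 / (5 * σ ^ 2)) - 4 / (5 * σ))

lemma one_le_modeConst : 1 ≤ modeConst := by
  unfold modeConst
  have h1 : 1 ≤ Real.exp 3 := Real.one_le_exp (by norm_num)
  have h2 : 1 ≤ √(2 * Real.pi) := Real.one_le_sqrt.2 (by linarith [Real.pi_gt_three])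
  nlinarith

lemma rateFactor_pos (σ : ℝ) : 0 < rateFactor σ := by unfold rateFactor; positivity

lemma rateFactor_le_one (hσ : 0 < σ) : rateFactor σ ≤ 1 := by
  have h1 : Real.exp (-(5 / 8)) ≤ 1 := Real.exp_le_one_iff.2 (by norm_num)
  have h2 : Real.exp (-(2 / (5 * σ ^ 2)) - 4 / (5 * σ)) ≤ 1 := by
    rw [Real.exp_le_one_iff]
    have : 0 < 2 / (5 * σ ^ 2) := by positivity
    have : 0 < 4 / (5 * σ) := by positivity
    linarith
  have h3 : Real.exp (-(5 / 8)) / (16 * Real.pi) ≤ 1 := by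
    rw [div_le_one (by positivity)]
    linarith [Real.pi_gt_three]
  exact mul_le_one₀ h3 (Real.exp_nonneg _) h2

lemma min_gaussMass_le_setFlow (hσ : 0 < σ) {m : ℝ} (hm : m = 1 ∨ m = -1) {A : Set ℝ}
    (hA : MeasurableSet A) :
    min (gaussMass σ m A) (gaussMass σ m Aᶜ) ≤ ENNReal.ofReal modeConst * setFlow σ A := by
  refine (min_setLIntegral_gaussDensity_le hσ m hA).trans ?_
  rw [modeConst, show 26 * Real.exp 3 * √(2 * Real.pi) = (13 * Real.exp 3 * √(2 * Real.pi)) * 2 by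
    ring, ENNReal.ofReal_mul (q := 2) (by positivity),
    mul_assoc _ (ENNReal.ofReal 2)]
  refine mul_le_mul' le_rfl ?_
  unfold setFlow
  rw [← lintegral_const_mul' _ _ ENNReal.ofReal_ne_top]
  refine lintegral_mono fun x => ?_
  rw [← lintegral_const_mul' _ _ ENNReal.ofReal_ne_top]
  refine lintegral_mono fun y => ?_
  rw [← ENNReal.ofReal_mul (by norm_num)]
  refine ENNReal.ofReal_le_ofReal ?_
  rw [mixFlow, ← mul_assoc]
  refine mul_le_mul_of_nonneg_right ?_ (gaussDensity_pos hσ _).le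
  have hx := half_gaussDensity_le_mixDensity hσ hm x
  have hy := half_gaussDensity_le_mixDensity hσ hm y
  rw [mul_min_of_nonneg _ _ (by norm_num)]
  exact min_le_min (by linarith) (by linarith)

/-- The value of the mode density at the far end of the window of radius `σ / 2` around a fifth
of the mode. -/
noncomputable def windowBound (σ : ℝ) : ℝ :=
  σ⁻¹ * (√(2 * Real.pi))⁻¹ * Real.exp (-((4 / 5 + σ / 2) ^ 2) / (2 * σ ^ 2))

lemma gaussDensity_ge (hσ : 0 < σ) {x b : ℝ} (hx : |x| ≤ b) :
    σ⁻¹ * (√(2 * Real.pi))⁻¹ * Real.exp (-(b ^ 2) / (2 * σ ^ 2)) ≤ gaussDensity σ x := by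
  rw [gaussDensity_eq hσ]
  have : x ^ 2 ≤ b ^ 2 := sq_le_sq' (by linarith [neg_le_of_abs_le hx]) (le_of_abs_le hx)
  gcongr

lemma windowBound_le_gaussDensity (hσ : 0 < σ) {m x : ℝ} (hm : m = 1 ∨ m = -1)
    (hx : x ∈ Metric.closedBall (m / 5) (σ / 2)) : windowBound σ ≤ gaussDensity σ (x - m) := by
  refine gaussDensity_ge hσ ?_
  rw [Metric.mem_closedBall, Real.dist_eq, abs_le] at hx
  rw [abs_le]
  rcases hm with rfl | rfl <;> constructor <;> linarith

lemma gaussDensity_ge_of_mem_windows (hσ : 0 < σ) {m x y : ℝ} (hm : m = 1 ∨ m = -1)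
    (hx : x ∈ Metric.closedBall (m / 5) (σ / 2)) (hy : y ∈ Metric.closedBall (-m / 5) (σ / 2)) :
    σ⁻¹ * (√(2 * Real.pi))⁻¹ * Real.exp (-((2 / 5 + σ) ^ 2) / (2 * σ ^ 2))
      ≤ gaussDensity σ (y - x) := by
  refine gaussDensity_ge hσ ?_
  rw [Metric.mem_closedBall, Real.dist_eq, abs_le] at hx hy
  rw [abs_le]
  rcases hm with rfl | rfl <;> constructor <;> linarith

lemma rateFactor_le_windowBound (hσ : 0 < σ) : rateFactor σ ≤ windowBound σ * (σ / 2) := by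
  have h1 : Real.exp (-(5 / 8)) * Real.exp (-(2 / (5 * σ ^ 2)) - 4 / (5 * σ))
      ≤ Real.exp (-((4 / 5 + σ / 2) ^ 2) / (2 * σ ^ 2)) := by
    rw [← Real.exp_add]
    apply Real.exp_le_exp.2
    have h : -((4 / 5 + σ / 2) ^ 2) / (2 * σ ^ 2)
        - (-(5 / 8) + (-(2 / (5 * σ ^ 2)) - 4 / (5 * σ)))
          = 1 / 2 + 2 / (25 * σ ^ 2) + 2 / (5 * σ) := by
      field_simp; ring
    have : 0 < 2 / (25 * σ ^ 2) := by positivity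
    have : 0 < 2 / (5 * σ) := by positivity
    linarith
  have h2 : 1 / (16 * Real.pi) ≤ (√(2 * Real.pi))⁻¹ / 2 := by
    rw [← one_div, div_div]
    apply one_div_le_one_div_of_le (by positivity)
    have h := Real.sq_sqrt (show 0 ≤ 2 * Real.pi by positivity)
    have : 1 ≤ √(2 * Real.pi) := Real.one_le_sqrt.2 (by linarith [Real.pi_gt_three])
    nlinarith
  calc rateFactor σ = 1 / (16 * Real.pi)
        * (Real.exp (-(5 / 8)) * Real.exp (-(2 / (5 * σ ^ 2)) - 4 / (5 * σ))) := by
        unfold rateFactor; ring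
    _ ≤ (√(2 * Real.pi))⁻¹ / 2 * Real.exp (-((4 / 5 + σ / 2) ^ 2) / (2 * σ ^ 2)) := by gcongr
    _ = _ := by unfold windowBound; field_simp

lemma rateFactor_eq (hσ : 0 < σ) :
    rateFactor σ = (1 / 2 * windowBound σ * (σ⁻¹ * (√(2 * Real.pi))⁻¹
      * Real.exp (-((2 / 5 + σ) ^ 2) / (2 * σ ^ 2)))) * (σ / 2) * (σ / 2) := by
  have h1 : Real.exp (-(5 / 8)) * Real.exp (-(2 / (5 * σ ^ 2)) - 4 / (5 * σ))
      = Real.exp (-((4 / 5 + σ / 2) ^ 2) / (2 * σ ^ 2))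
        * Real.exp (-((2 / 5 + σ) ^ 2) / (2 * σ ^ 2)) := by
    rw [← Real.exp_add, ← Real.exp_add]
    congr 1
    field_simp; ring
  have h2 : (√(2 * Real.pi))⁻¹ * (√(2 * Real.pi))⁻¹ = 1 / (2 * Real.pi) := by
    rw [← mul_inv, Real.mul_self_sqrt (by positivity), one_div]
  calc rateFactor σ = 1 / (16 * Real.pi)
        * (Real.exp (-(5 / 8)) * Real.exp (-(2 / (5 * σ ^ 2)) - 4 / (5 * σ))) := by
        unfold rateFactor; ring
    _ = 1 / 8 * ((√(2 * Real.pi))⁻¹ * (√(2 * Real.pi))⁻¹)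
        * (Real.exp (-((4 / 5 + σ / 2) ^ 2) / (2 * σ ^ 2))
          * Real.exp (-((2 / 5 + σ) ^ 2) / (2 * σ ^ 2))) := by rw [h1, h2]; ring
    _ = _ := by unfold windowBound; field_simp; ring

lemma rateFactor_le_gaussMass (hσ : 0 < σ) {m : ℝ} (hm : m = 1 ∨ m = -1) {A : Set ℝ}
    (hA : MeasurableSet A)
    (hvol : ENNReal.ofReal (σ / 2) ≤ volume (A ∩ Metric.closedBall (m / 5) (σ / 2))) :
    ENNReal.ofReal (rateFactor σ) ≤ gaussMass σ m A := by
  have hw : 0 ≤ windowBound σ := by unfold windowBound; positivity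
  calc ENNReal.ofReal (rateFactor σ)
      ≤ ENNReal.ofReal (windowBound σ) * volume (A ∩ Metric.closedBall (m / 5) (σ / 2)) := by
        refine le_trans ?_ (mul_le_mul_right hvol _)
        rw [← ENNReal.ofReal_mul hw]
        exact ENNReal.ofReal_le_ofReal (rateFactor_le_windowBound hσ)
    _ = ∫⁻ _ in A ∩ Metric.closedBall (m / 5) (σ / 2), ENNReal.ofReal (windowBound σ) := by
        rw [setLIntegral_const]
    _ ≤ ∫⁻ x in A ∩ Metric.closedBall (m / 5) (σ / 2), ENNReal.ofReal (gaussDensity σ (x - m)) :=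
        setLIntegral_mono' (hA.inter measurableSet_closedBall) fun x hx =>
          ENNReal.ofReal_le_ofReal (windowBound_le_gaussDensity hσ hm hx.2)
    _ ≤ gaussMass σ m A := lintegral_mono_set inter_subset_left

lemma rateFactor_le_setFlow (hσ : 0 < σ) {m : ℝ} (hm : m = 1 ∨ m = -1) {A : Set ℝ}
    (hA : MeasurableSet A)
    (h1 : ENNReal.ofReal (σ / 2) ≤ volume (A ∩ Metric.closedBall (m / 5) (σ / 2)))
    (h2 : ENNReal.ofReal (σ / 2) ≤ volume (Aᶜ ∩ Metric.closedBall (-m / 5) (σ / 2))) :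
    ENNReal.ofReal (rateFactor σ) ≤ setFlow σ A := by
  set k := 1 / 2 * windowBound σ * (σ⁻¹ * (√(2 * Real.pi))⁻¹
      * Real.exp (-((2 / 5 + σ) ^ 2) / (2 * σ ^ 2))) with hk
  have hw : 0 ≤ windowBound σ := by unfold windowBound; positivity
  have hk0 : 0 ≤ k := by positivity
  set V := A ∩ Metric.closedBall (m / 5) (σ / 2) with hV
  set W := Aᶜ ∩ Metric.closedBall (-m / 5) (σ / 2) with hW
  have hm' : -m = 1 ∨ -m = -1 := by rcases hm with rfl | rfl <;> simp
  have hkf : ∀ x ∈ V, ∀ y ∈ W, k ≤ mixFlow σ x y := fun x hx y hy => by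
    unfold mixFlow
    refine mul_le_mul (le_min ?_ ?_) (gaussDensity_ge_of_mem_windows hσ hm hx.2 hy.2)
      (by positivity) (lt_min (mixDensity_pos hσ x) (mixDensity_pos hσ y)).le
    · have := windowBound_le_gaussDensity hσ hm hx.2
      have := half_gaussDensity_le_mixDensity hσ hm x
      linarith
    · have := windowBound_le_gaussDensity hσ hm' hy.2
      have := half_gaussDensity_le_mixDensity hσ hm' y
      linarith
  calc ENNReal.ofReal (rateFactor σ)
      = ENNReal.ofReal k * ENNReal.ofReal (σ / 2) * ENNReal.ofReal (σ / 2) := by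
        rw [rateFactor_eq hσ, ENNReal.ofReal_mul (by positivity), ENNReal.ofReal_mul hk0]
    _ ≤ ENNReal.ofReal k * volume W * volume V := by gcongr
    _ = ∫⁻ _ in V, ∫⁻ _ in W, ENNReal.ofReal k := by simp only [setLIntegral_const]
    _ ≤ ∫⁻ x in V, ∫⁻ y in W, ENNReal.ofReal (mixFlow σ x y) :=
        setLIntegral_mono' (hA.inter measurableSet_closedBall) fun x hx =>
          setLIntegral_mono' (hA.compl.inter measurableSet_closedBall) fun y hy =>
            ENNReal.ofReal_le_ofReal (hkf x hx y hy)
    _ ≤ ∫⁻ x in V, ∫⁻ y in Aᶜ, ENNReal.ofReal (mixFlow σ x y) :=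
        lintegral_mono fun x => lintegral_mono_set inter_subset_left
    _ ≤ setFlow σ A := lintegral_mono_set inter_subset_left

lemma volume_window_inter_or (hσ : 0 < σ) (c : ℝ) {A : Set ℝ} (hA : MeasurableSet A) :
    ENNReal.ofReal (σ / 2) ≤ volume (A ∩ Metric.closedBall c (σ / 2))
      ∨ ENNReal.ofReal (σ / 2) ≤ volume (Aᶜ ∩ Metric.closedBall c (σ / 2)) := by
  by_contra! h
  have h1 : volume (A ∩ Metric.closedBall c (σ / 2)) + volume (Aᶜ ∩ Metric.closedBall c (σ / 2))
      = ENNReal.ofReal (σ / 2) + ENNReal.ofReal (σ / 2) := by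
    rw [← Measure.restrict_apply hA, ← Measure.restrict_apply hA.compl,
      measure_add_measure_compl hA, Measure.restrict_apply_univ, Real.volume_closedBall,
      ← ENNReal.ofReal_add (by positivity) (by positivity)]
    congr 1; ring
  exact (ENNReal.add_lt_add h.1 h.2).ne h1

lemma rateFactor_le_of_gaussMass (hσ : 0 < σ) {m : ℝ} (hm : m = 1 ∨ m = -1) {A : Set ℝ}
    (hA : MeasurableSet A) (h1 : gaussMass σ m Aᶜ ≤ gaussMass σ m A)
    (h2 : gaussMass σ (-m) A ≤ gaussMass σ (-m) Aᶜ) :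
    ENNReal.ofReal (rateFactor σ) ≤ ENNReal.ofReal modeConst * setFlow σ A := by
  have hm' : -m = 1 ∨ -m = -1 := by rcases hm with rfl | rfl <;> simp
  have h3 := min_gaussMass_le_setFlow hσ hm hA
  have h4 := min_gaussMass_le_setFlow hσ hm' hA
  rw [min_eq_right h1] at h3
  rw [min_eq_left h2] at h4
  rcases volume_window_inter_or hσ (m / 5) hA with h5 | h5
  · rcases volume_window_inter_or hσ (-m / 5) hA with h6 | h6
    · exact (rateFactor_le_gaussMass hσ hm' hA h6).trans h4
    · refine (rateFactor_le_setFlow hσ hm hA h5 h6).trans ?_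
      exact le_mul_of_one_le_left' (by rw [ENNReal.one_le_ofReal]; exact one_le_modeConst)
  · exact (rateFactor_le_gaussMass hσ hm hA.compl h5).trans h3

lemma rateFactor_mul_mixMass_le (hσ : 0 < σ) {A : Set ℝ} (hA : MeasurableSet A)
    (hmass : 2 * mixMass σ A ≤ 1) :
    ENNReal.ofReal (rateFactor σ) * mixMass σ A ≤ ENNReal.ofReal modeConst * setFlow σ A := by
  have hle1 : mixMass σ A ≤ 1 :=
    (le_mul_of_one_le_left' (by norm_num)).trans hmass
  have hc1 := gaussMass_add_compl hσ 1 hA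
  have hc2 := gaussMass_add_compl hσ (-1) hA
  rw [two_mul_mixMass hσ] at hmass
  have hr : ENNReal.ofReal (rateFactor σ) ≤ 1 := by
    rw [ENNReal.ofReal_le_one]; exact rateFactor_le_one hσ
  have hle : ∀ {m}, gaussMass σ m A ≠ ∞ → gaussMass σ m A + gaussMass σ m Aᶜ = 1 →
      ∀ m', gaussMass σ m A + gaussMass σ m' A ≤ 1 → gaussMass σ m' A ≤ gaussMass σ m Aᶜ := by
    intro m hfin hm m' hm'
    rw [← hm] at hm'
    exact (ENNReal.add_le_add_iff_left hfin).1 hm'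
  have hf1 : gaussMass σ 1 A ≠ ∞ :=
    ne_top_of_le_ne_top ENNReal.one_ne_top (hc1 ▸ le_self_add)
  have hf2 : gaussMass σ (-1) A ≠ ∞ :=
    ne_top_of_le_ne_top ENNReal.one_ne_top (hc2 ▸ le_self_add)
  have hx1 := hle hf1 hc1 (-1) hmass
  have hx2 := hle hf2 hc2 1 (by rwa [add_comm])
  have hend : ENNReal.ofReal (rateFactor σ) ≤ ENNReal.ofReal modeConst * setFlow σ A →
      ENNReal.ofReal (rateFactor σ) * mixMass σ A ≤ ENNReal.ofReal modeConst * setFlow σ A :=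
    fun h => (mul_le_of_le_one_right' hle1).trans h
  rcases le_total (gaussMass σ 1 A) (gaussMass σ 1 Aᶜ) with h1 | h1
  · rcases le_total (gaussMass σ (-1) A) (gaussMass σ (-1) Aᶜ) with h2 | h2
    · have h3 := min_gaussMass_le_setFlow hσ (Or.inl rfl) hA
      have h4 := min_gaussMass_le_setFlow hσ (Or.inr rfl) hA
      rw [min_eq_left h1] at h3
      rw [min_eq_left h2] at h4
      refine (mul_le_of_le_one_left' hr).trans ?_
      refine (ENNReal.mul_le_mul_iff_right (a := 2) (by simp) (by simp)).1 ?_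
      rw [two_mul_mixMass hσ, two_mul (ENNReal.ofReal modeConst * setFlow σ A)]
      exact add_le_add h3 h4
    · exact hend (rateFactor_le_of_gaussMass hσ (Or.inr rfl) hA h2 (by rwa [neg_neg]))
  · exact hend (rateFactor_le_of_gaussMass hσ (Or.inl rfl) hA h1 (hx1.trans (h1.trans hx2)))

end LowerBound

section UpperBound

variable {σ : ℝ}

lemma gaussDensity_le_of_sq_le (hσ : 0 < σ) {x y : ℝ} (h : y ^ 2 ≤ x ^ 2) :
    gaussDensity σ x ≤ gaussDensity σ y := by
  rw [gaussDensity_eq hσ, gaussDensity_eq hσ]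
  gcongr

lemma mixDensity_le_of_nonpos (hσ : 0 < σ) {x : ℝ} (hx : x ≤ 0) :
    mixDensity σ x ≤ gaussDensity σ (x + 1) := by
  have := gaussDensity_le_of_sq_le hσ (x := x - 1) (y := x + 1) (by nlinarith)
  unfold mixDensity; linarith

lemma mixDensity_le_of_nonneg (hσ : 0 < σ) {x : ℝ} (hx : 0 ≤ x) :
    mixDensity σ x ≤ gaussDensity σ (x - 1) := by
  have := gaussDensity_le_of_sq_le hσ (x := x + 1) (y := x - 1) (by nlinarith)
  unfold mixDensity; linarith

lemma min_exp_mul_exp_le (hσ : 0 < σ) (x y : ℝ) :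
    min (Real.exp (-((x + 1) ^ 2) / (2 * σ ^ 2))) (Real.exp (-((y - 1) ^ 2) / (2 * σ ^ 2)))
        * Real.exp (-((y - x) ^ 2) / (2 * σ ^ 2))
      ≤ Real.exp (-(2 / (5 * σ ^ 2))) * Real.exp (-((x - -(1 / 5)) ^ 2) / (2 * (2 * σ ^ 2)))
        * Real.exp (-((y - 1 / 5) ^ 2) / (2 * (2 * σ ^ 2))) := by
  have hmin : ∀ u v : ℝ, min (Real.exp u) (Real.exp v) ≤ Real.exp ((u + v) / 2) := fun u v => by
    rcases le_total u v with h | h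
    · exact (min_le_left _ _).trans (Real.exp_le_exp.2 (by linarith))
    · exact (min_le_right _ _).trans (Real.exp_le_exp.2 (by linarith))
  refine (mul_le_mul_of_nonneg_right (hmin _ _) (Real.exp_nonneg _)).trans ?_
  rw [← Real.exp_add, ← Real.exp_add, ← Real.exp_add]
  apply Real.exp_le_exp.2
  have h : (-(2 / (5 * σ ^ 2)) + -((x - -(1 / 5)) ^ 2) / (2 * (2 * σ ^ 2))
        + -((y - 1 / 5) ^ 2) / (2 * (2 * σ ^ 2)))
      - ((-((x + 1) ^ 2) / (2 * σ ^ 2) + -((y - 1) ^ 2) / (2 * σ ^ 2)) / 2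
        + -((y - x) ^ 2) / (2 * σ ^ 2))
      = (y - x - 2 / 5) ^ 2 / (2 * σ ^ 2) := by
    field_simp; ring
  have : 0 ≤ (y - x - 2 / 5) ^ 2 / (2 * σ ^ 2) := by positivity
  linarith

lemma mixFlow_le_prod (hσ : 0 < σ) {x y : ℝ} (hx : x ≤ 0) (hy : 0 ≤ y) :
    mixFlow σ x y ≤ 2 * Real.exp (-(2 / (5 * σ ^ 2)))
      * gaussDensity (√2 * σ) (x - -(1 / 5)) * gaussDensity (√2 * σ) (y - 1 / 5) := by
  set a := (√(2 * Real.pi))⁻¹ with ha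
  have hs : (√2 * σ) ^ 2 = 2 * σ ^ 2 := by rw [mul_pow, Real.sq_sqrt (by norm_num)]
  have hs' : (√2 * σ)⁻¹ * (√2 * σ)⁻¹ = σ⁻¹ * σ⁻¹ / 2 := by
    rw [← mul_inv, ← sq, hs]; field_simp
  calc mixFlow σ x y
      ≤ min (gaussDensity σ (x + 1)) (gaussDensity σ (y - 1)) * gaussDensity σ (y - x) :=
        mul_le_mul_of_nonneg_right
          (min_le_min (mixDensity_le_of_nonpos hσ hx) (mixDensity_le_of_nonneg hσ hy))
          (gaussDensity_pos hσ _).le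
    _ = (σ⁻¹ * a) * (σ⁻¹ * a) * (min (Real.exp (-((x + 1) ^ 2) / (2 * σ ^ 2)))
          (Real.exp (-((y - 1) ^ 2) / (2 * σ ^ 2))) * Real.exp (-((y - x) ^ 2) / (2 * σ ^ 2))) := by
        rw [gaussDensity_eq hσ, gaussDensity_eq hσ, gaussDensity_eq hσ,
          ← mul_min_of_nonneg _ _ (by positivity)]
        ring
    _ ≤ (σ⁻¹ * a) * (σ⁻¹ * a) * (Real.exp (-(2 / (5 * σ ^ 2)))
          * Real.exp (-((x - -(1 / 5)) ^ 2) / (2 * (2 * σ ^ 2)))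
          * Real.exp (-((y - 1 / 5) ^ 2) / (2 * (2 * σ ^ 2)))) :=
        mul_le_mul_of_nonneg_left (min_exp_mul_exp_le hσ x y) (by positivity)
    _ = 2 * ((√2 * σ)⁻¹ * (√2 * σ)⁻¹) * (a * a) * (Real.exp (-(2 / (5 * σ ^ 2)))
          * Real.exp (-((x - -(1 / 5)) ^ 2) / (2 * (2 * σ ^ 2)))
          * Real.exp (-((y - 1 / 5) ^ 2) / (2 * (2 * σ ^ 2)))) := by
        rw [hs']; ring
    _ = _ := by
        rw [gaussDensity_eq (by positivity), gaussDensity_eq (by positivity), hs]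
        ring

lemma setFlow_Iio_le (hσ : 0 < σ) :
    setFlow σ (Iio 0) ≤ ENNReal.ofReal (2 * Real.exp (-(2 / (5 * σ ^ 2)))) := by
  have hs : 0 < √2 * σ := by positivity
  set c := 2 * Real.exp (-(2 / (5 * σ ^ 2))) with hc
  have hc0 : 0 ≤ c := by positivity
  calc setFlow σ (Iio 0)
      ≤ ∫⁻ x in Iio (0 : ℝ), ENNReal.ofReal (c * gaussDensity (√2 * σ) (x - -(1 / 5))) := by
        refine setLIntegral_mono' measurableSet_Iio fun x hx => ?_
        calc ∫⁻ y in (Iio (0 : ℝ))ᶜ, ENNReal.ofReal (mixFlow σ x y)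
            ≤ ∫⁻ y in (Iio (0 : ℝ))ᶜ, ENNReal.ofReal (c * gaussDensity (√2 * σ) (x - -(1 / 5)))
                * ENNReal.ofReal (gaussDensity (√2 * σ) (y - 1 / 5)) := by
              refine setLIntegral_mono' measurableSet_Iio.compl fun y hy => ?_
              rw [← ENNReal.ofReal_mul (mul_nonneg hc0 (gaussDensity_pos hs _).le)]
              exact ENNReal.ofReal_le_ofReal
                (mixFlow_le_prod hσ (le_of_lt hx) (by simpa using hy))
          _ ≤ _ := by
              refine (setLIntegral_le_lintegral _ _).trans ?_
              rw [lintegral_const_mul' _ _ ENNReal.ofReal_ne_top, lintegral_gaussDensity_sub hs,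
                mul_one]
    _ ≤ ENNReal.ofReal c := by
        refine (setLIntegral_le_lintegral _ _).trans ?_
        simp only [ENNReal.ofReal_mul hc0]
        rw [lintegral_const_mul' _ _ ENNReal.ofReal_ne_top, lintegral_gaussDensity_sub hs, mul_one]

lemma PhiHalf_eq (hσ : 0 < σ) : PhiHalf σ = 2 * (setFlow σ (Iio 0)).toReal := by
  rw [PhiHalf, ← setIntegral_rwmProb_compl hσ measurableSet_Iio, compl_Iio]

lemma PhiHalf_le (hσ : 0 < σ) : PhiHalf σ ≤ 4 * Real.exp (-(2 / (5 * σ ^ 2))) := by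
  rw [PhiHalf_eq hσ]
  have := ENNReal.toReal_mono ENNReal.ofReal_ne_top (setFlow_Iio_le hσ)
  rw [ENNReal.toReal_ofReal (by positivity)] at this
  linarith

end UpperBound

section Conductance

variable {σ : ℝ}

lemma mixMass_univ (hσ : 0 < σ) : mixMass σ univ = 1 := by
  have h := two_mul_mixMass hσ univ
  rw [gaussMass, gaussMass, setLIntegral_univ, setLIntegral_univ, lintegral_gaussDensity_sub hσ,
    lintegral_gaussDensity_sub hσ, one_add_one_eq_two] at h
  exact (ENNReal.mul_right_inj (by simp) (by simp)).1 (h.trans (mul_one 2).symm)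

lemma mixDensity_neg (σ x : ℝ) : mixDensity σ (-x) = mixDensity σ x := by
  have h : ∀ y, gaussDensity σ (-y) = gaussDensity σ y := fun y => by
    rw [gaussDensity, neg_sq, gaussDensity]
  rw [mixDensity, mixDensity, ← h (-x + 1), ← h (-x - 1), add_comm]
  ring_nf

lemma setIntegral_mixDensity_Iio (hσ : 0 < σ) : ∫ x in Iio (0 : ℝ), mixDensity σ x = 1 / 2 := by
  have h1 : ∫ x in Iic (0 : ℝ), mixDensity σ x = ∫ x in Ioi (0 : ℝ), mixDensity σ x := by
    have := integral_comp_neg_Iic (0 : ℝ) (mixDensity σ)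
    simpa only [mixDensity_neg, neg_zero] using this
  have h2 := integral_add_compl (measurableSet_Iic (a := (0 : ℝ))) (integrable_mixDensity σ)
  have h3 := setIntegral_mixDensity hσ univ
  rw [setIntegral_univ, mixMass_univ hσ, ENNReal.toReal_one] at h3
  rw [compl_Iic, h3, ← h1] at h2
  rw [← integral_Iic_eq_integral_Iio]
  linarith

lemma rateFactor_div_modeConst_le (hσ : 0 < σ) {A : Set ℝ} (hA : MeasurableSet A)
    (hpos : 0 < ∫ x in A, mixDensity σ x) (hle : ∫ x in A, mixDensity σ x ≤ 1 / 2) :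
    rateFactor σ / modeConst
      ≤ (∫ x in A, rwmProb σ x Aᶜ * mixDensity σ x) / ∫ x in A, mixDensity σ x := by
  have hc : 0 < modeConst := one_pos.trans_le one_le_modeConst
  rw [div_le_div_iff₀ hc hpos, setIntegral_rwmProb_compl hσ hA]
  rw [setIntegral_mixDensity hσ] at hle ⊢
  have hmass : 2 * mixMass σ A ≤ 1 := by
    rw [← ENNReal.ofReal_toReal (mixMass_ne_top σ A), ← ENNReal.ofReal_ofNat,
      ← ENNReal.ofReal_mul (by norm_num), ENNReal.ofReal_le_one]
    linarith
  have h := ENNReal.toReal_mono (ENNReal.mul_ne_top ENNReal.ofReal_ne_top (setFlow_ne_top hσ A))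
    (rateFactor_mul_mixMass_le hσ hA hmass)
  rw [ENNReal.toReal_mul, ENNReal.toReal_mul, ENNReal.toReal_ofReal hc.le,
    ENNReal.toReal_ofReal (rateFactor_pos σ).le] at h
  linarith

lemma PhiHalf_mem (hσ : 0 < σ) :
    PhiHalf σ ∈ { r : ℝ | ∃ A : Set ℝ, MeasurableSet A ∧ (0 < ∫ x in A, mixDensity σ x) ∧
      (∫ x in A, mixDensity σ x) ≤ 1 / 2 ∧
      r = (∫ x in A, rwmProb σ x Aᶜ * mixDensity σ x) / ∫ x in A, mixDensity σ x } := by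
  have h := setIntegral_mixDensity_Iio hσ
  refine ⟨Iio 0, measurableSet_Iio, ?_, h.le, ?_⟩
  · rw [h]; norm_num
  · rw [h, PhiHalf, compl_Iio]; ring

lemma le_PhiGlobal (hσ : 0 < σ) : rateFactor σ / modeConst ≤ PhiGlobal σ := by
  refine le_csInf ⟨_, PhiHalf_mem hσ⟩ ?_
  rintro r ⟨A, hA, hpos, hle, rfl⟩
  exact rateFactor_div_modeConst_le hσ hA hpos hle

lemma PhiGlobal_le_PhiHalf (hσ : 0 < σ) : PhiGlobal σ ≤ PhiHalf σ := by
  refine csInf_le ⟨rateFactor σ / modeConst, ?_⟩ (PhiHalf_mem hσ)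
  rintro r ⟨A, hA, hpos, hle, rfl⟩
  exact rateFactor_div_modeConst_le hσ hA hpos hle

end Conductance

/-- On a logarithmic scale, the half line `(-∞,0)` asymptotically achieves the worst
conductance: `lim_{σ→0} log Φ(K_σ) / log Φ_σ = 1`. -/
theorem stmt4 :
    Filter.Tendsto (fun σ : ℝ => Real.log (PhiGlobal σ) / Real.log (PhiHalf σ))
      (nhdsWithin 0 (Set.Ioi 0)) (nhds 1) := by
  have hc : 0 < modeConst := one_pos.trans_le one_le_modeConst
  set c : ℝ := Real.log (Real.exp (-(5 / 8)) / (16 * Real.pi) / modeConst) with hcdef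
  have hlogL : ∀ σ, Real.log (rateFactor σ / modeConst)
      = c + (-(2 / (5 * σ ^ 2)) - 4 / (5 * σ)) := fun σ => by
    rw [rateFactor, mul_div_right_comm, Real.log_mul (by positivity) (Real.exp_ne_zero _),
      Real.log_exp]
  have hlogU : ∀ σ, Real.log (4 * Real.exp (-(2 / (5 * σ ^ 2))))
      = Real.log 4 - 2 / (5 * σ ^ 2) := fun σ => by
    rw [Real.log_mul (by norm_num) (Real.exp_ne_zero _), Real.log_exp]; ring
  have hnum : Tendsto (fun σ : ℝ => (c * σ ^ 2 - 2 / 5 - 4 / 5 * σ)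
      / (Real.log 4 * σ ^ 2 - 2 / 5)) (nhdsWithin 0 (Ioi 0)) (nhds 1) := by
    have : ContinuousAt (fun σ : ℝ => (c * σ ^ 2 - 2 / 5 - 4 / 5 * σ)
        / (Real.log 4 * σ ^ 2 - 2 / 5)) 0 :=
      ContinuousAt.div (by fun_prop) (by fun_prop) (by norm_num)
    have h := this.tendsto.mono_left (nhdsWithin_le_nhds (s := Ioi 0))
    norm_num at h
    exact h
  have hneg : ∀ᶠ σ : ℝ in nhdsWithin 0 (Ioi 0), Real.log 4 * σ ^ 2 - 2 / 5 < 0 := by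
    have : ContinuousAt (fun σ : ℝ => Real.log 4 * σ ^ 2 - 2 / 5) 0 := by fun_prop
    exact (this.eventually (gt_mem_nhds (by norm_num))).filter_mono nhdsWithin_le_nhds
  refine tendsto_of_tendsto_of_tendsto_of_le_of_le' tendsto_const_nhds hnum ?_ ?_
  all_goals
    filter_upwards [hneg, self_mem_nhdsWithin] with σ hσn hσ
    have hσ : 0 < σ := hσ
    have h0 : 0 < rateFactor σ / modeConst := div_pos (rateFactor_pos σ) hc
    have h1 := le_PhiGlobal hσ
    have h2 := PhiGlobal_le_PhiHalf hσ
    have hG : 0 < PhiGlobal σ := h0.trans_le h1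
    have hH : 0 < PhiHalf σ := hG.trans_le h2
    have hlog1 := Real.log_le_log h0 h1
    have hlog2 := Real.log_le_log hG h2
    have hlog3 := Real.log_le_log hH (PhiHalf_le hσ)
    rw [hlogL] at hlog1
    rw [hlogU] at hlog3
    have hU : Real.log 4 - 2 / (5 * σ ^ 2) < 0 := by
      have : Real.log 4 - 2 / (5 * σ ^ 2) = (Real.log 4 * σ ^ 2 - 2 / 5) / σ ^ 2 := by field_simp
      rw [this]
      exact div_neg_of_neg_of_pos hσn (by positivity)
  · rw [one_le_div_of_neg (hlog3.trans_lt hU)]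
    exact hlog2
  · calc Real.log (PhiGlobal σ) / Real.log (PhiHalf σ)
        = -Real.log (PhiGlobal σ) / -Real.log (PhiHalf σ) := (neg_div_neg_eq _ _).symm
      _ ≤ -(c + (-(2 / (5 * σ ^ 2)) - 4 / (5 * σ))) / -(Real.log 4 - 2 / (5 * σ ^ 2)) := by
          apply div_le_div₀ <;> linarith
      _ = _ := by
          rw [neg_div_neg_eq, ← mul_div_mul_right _ _ (pow_pos hσ 2).ne']
          congr 1
          · field_simp
            ring
          · field_simp
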